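/- For every integer k ≥ 1, let D₁, D₂, D₃ be the 3×3 matrices over ℚ (rows listed top to bottom) D₁ = [[1+144k, 576k², 0],[-36, 1-144k, 0],[12, 48k, 1]], D₂ = [[1,4,0],[0,1,0],[0,0,1]], D₃ = [[1,0,0],[-4,1,0],[0,0,1]]. Then D₂^{k} · D₁ · D₂^{-k} · D₃^{-9} = [[1,0,0],[0,1,0],[12,0,1]], a non-identity matrix of the form [[1,0,0],[0,1,0],[y,x,1]]. -/

import Mathlib

open Matrix

/-- Integer powers along a one-parameter family of matrices. -/
theorem Matrix.zpow_of_map_add {n R : Type*} [Fintype n] [DecidableEq n] [CommRing R]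
    (f : R → Matrix n n R) (map_zero : f 0 = 1) (map_add : ∀ a b, f (a + b) = f a * f b)
    (a : R) (m : ℤ) : f a ^ m = f (m * a) := by
  have hpow (j : ℕ) : f a ^ j = f (j * a) := by
    induction j with
    | zero => simp [map_zero]
    | succ j ih => rw [pow_succ, ih, ← map_add]; congr 1; push_cast; ring
  obtain ⟨j, rfl | rfl⟩ := m.eq_nat_or_neg
  · simpa using hpow j
  · have hdet : IsUnit (f a).det := by
      rw [← Matrix.isUnit_iff_isUnit_det]
      refine IsUnit.of_mul_eq_one (f (-a)) ?_
      rw [← map_add, add_neg_cancel, map_zero]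
    rw [Matrix.zpow_neg hdet, zpow_natCast, hpow]
    apply Matrix.inv_eq_right_inv
    rw [← map_add, ← map_zero]
    congr 1
    push_cast
    ring

theorem upper_unipotent_zpow (a : ℚ) (m : ℤ) :
    !![1, a, 0; 0, 1, 0; 0, 0, 1] ^ m = !![1, m * a, 0; 0, 1, 0; 0, 0, 1] := by
  refine Matrix.zpow_of_map_add (fun x : ℚ => !![1, x, 0; 0, 1, 0; 0, 0, 1])
    Matrix.one_fin_three.symm (fun x y => ?_) a m
  simp [add_comm]

theorem lower_unipotent_zpow (a : ℚ) (m : ℤ) :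
    !![1, 0, 0; a, 1, 0; 0, 0, 1] ^ m = !![1, 0, 0; m * a, 1, 0; 0, 0, 1] := by
  refine Matrix.zpow_of_map_add (fun x : ℚ => !![1, 0, 0; x, 1, 0; 0, 0, 1])
    Matrix.one_fin_three.symm (fun x y => ?_) a m
  simp

/-- A nontrivial unipotent-radical element for the family `F_{6n+14}` with `n = 4k-2`. -/
theorem unipotent_word_F6n14 (k : ℤ) (hk : 1 ≤ k)
    (D₁ D₂ D₃ : Matrix (Fin 3) (Fin 3) ℚ)
    (h₁ : D₁ = !![1 + 144*(k:ℚ), 576*(k:ℚ)^2, 0;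
                  -36, 1 - 144*(k:ℚ), 0;
                  12, 48*(k:ℚ), 1])
    (h₂ : D₂ = !![1, 4, 0; 0, 1, 0; 0, 0, 1])
    (h₃ : D₃ = !![1, 0, 0; -4, 1, 0; 0, 0, 1]) :
    D₂ ^ (k : ℤ) * D₁ * D₂ ^ (-k : ℤ) * D₃ ^ (-9 : ℤ)
      = !![1, 0, 0; 0, 1, 0; 12, 0, 1] ∧
    !![1, 0, 0; 0, 1, 0; (12:ℚ), 0, 1] ≠ (1 : Matrix (Fin 3) (Fin 3) ℚ) := by
  subst h₁ h₂ h₃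
  refine ⟨?_, fun h => ?_⟩
  · rw [upper_unipotent_zpow, upper_unipotent_zpow, lower_unipotent_zpow]
    ext i j
    fin_cases i <;> fin_cases j <;> simp <;> ring
  · simpa using congrFun (congrFun h 2) 0
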